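/- arXiv:2105.05174 — 3 statements merged into one kernel-verified Lean document; each statement's English description precedes it below -/
import Mathlib

section
/- Let L be a lattice in ℝ² of covolume 1 with ‖L‖ < 1. Then the minimal norm of L is attained at exactly two vectors: there exists l ∈ L∖{0} such that {v ∈ L : ‖v‖ = ‖L‖} = {l, −l}. -/
noncomputable section

/-- The minimal norm of the nonzero vectors of a set `L` in a normed group:
`‖L‖ = inf {‖x‖ : x ∈ L ∖ {0}}`. -/
def setMinNorm {E : Type*} [NormedAddCommGroup E] (L : Set E) : ℝ :=
  sInf {r : ℝ | ∃ x ∈ L, x ≠ 0 ∧ ‖x‖ = r}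

/-- The lattice `A·ℤ² ⊆ ℝ²` associated to a matrix `A`. -/
def lat2 (A : Matrix (Fin 2) (Fin 2) ℝ) : Set (EuclideanSpace ℝ (Fin 2)) :=
  {x | ∃ v : Fin 2 → ℤ, x = (WithLp.equiv 2 (Fin 2 → ℝ)).symm (A.mulVec fun i => (v i : ℝ))}

/-- The vector of the lattice `A·ℤ²` with integer coordinates `v`. -/
def latVec (A : Matrix (Fin 2) (Fin 2) ℝ) (v : Fin 2 → ℤ) : EuclideanSpace ℝ (Fin 2) :=
  (WithLp.equiv 2 (Fin 2 → ℝ)).symm (A.mulVec fun i => (v i : ℝ))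

lemma latVec_apply (A : Matrix (Fin 2) (Fin 2) ℝ) (v : Fin 2 → ℤ) (i : Fin 2) :
    latVec A v i = A i 0 * v 0 + A i 1 * v 1 := by
  fin_cases i <;> simp [latVec]

lemma latVec_zsmul (A : Matrix (Fin 2) (Fin 2) ℝ) (k : ℤ) (v : Fin 2 → ℤ) :
    latVec A (k • v) = (k : ℝ) • latVec A v := by
  ext i
  simp only [latVec_apply, PiLp.smul_apply, Pi.smul_apply, smul_eq_mul, Int.cast_mul]
  ring

/-- Two vectors of norm less than one in a lattice of covolume one are parallel. -/
lemma int_cross_eq_zero_of_norm_lt_one {A : Matrix (Fin 2) (Fin 2) ℝ} (hA : |A.det| = 1)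
    {u w : Fin 2 → ℤ} (hu : ‖latVec A u‖ < 1) (hw : ‖latVec A w‖ < 1) :
    u 0 * w 1 = u 1 * w 0 := by
  have norm_sq (x : EuclideanSpace ℝ (Fin 2)) : ‖x‖ ^ 2 = x 0 ^ 2 + x 1 ^ 2 := by
    simp [EuclideanSpace.real_norm_sq_eq, Fin.sum_univ_two]
  have hu2 : ‖latVec A u‖ ^ 2 < 1 := pow_lt_one₀ (norm_nonneg _) hu two_ne_zero
  have hw2 : ‖latVec A w‖ ^ 2 < 1 := pow_lt_one₀ (norm_nonneg _) hw two_ne_zero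
  have hlt : ‖latVec A u‖ ^ 2 * ‖latVec A w‖ ^ 2 < 1 :=
    mul_lt_one_of_nonneg_of_lt_one_left (sq_nonneg _) hu2 hw2.le
  have hdet : A.det ^ 2 = 1 := by rw [← sq_abs, hA, one_pow]
  have hcross : latVec A u 0 * latVec A w 1 - latVec A u 1 * latVec A w 0 =
      A.det * (u 0 * w 1 - u 1 * w 0) := by
    simp only [latVec_apply, Matrix.det_fin_two]
    ring
  have hreal : ((u 0 * w 1 - u 1 * w 0 : ℝ)) ^ 2 < 1 := by
    calc ((u 0 * w 1 - u 1 * w 0 : ℝ)) ^ 2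
        = (latVec A u 0 * latVec A w 1 - latVec A u 1 * latVec A w 0) ^ 2 := by
          rw [hcross, mul_pow, hdet, one_mul]
      _ ≤ ‖latVec A u‖ ^ 2 * ‖latVec A w‖ ^ 2 := by
          rw [norm_sq, norm_sq]
          nlinarith [sq_nonneg (latVec A u 0 * latVec A w 0 + latVec A u 1 * latVec A w 1)]
      _ < 1 := hlt
  have hint : (u 0 * w 1 - u 1 * w 0) ^ 2 < 1 := by exact_mod_cast hreal
  have hzero : (u 0 * w 1 - u 1 * w 0) ^ 2 = 0 := by
    have := sq_nonneg (u 0 * w 1 - u 1 * w 0)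
    omega
  exact sub_eq_zero.mp (pow_eq_zero_iff two_ne_zero |>.mp hzero)

/-- The integer vectors parallel to a nonzero integer vector are the multiples of a
primitive one. -/
lemma exists_primitive {u : Fin 2 → ℤ} (hu : u ≠ 0) :
    ∃ p : Fin 2 → ℤ, ∀ w : Fin 2 → ℤ, u 0 * w 1 = u 1 * w 0 → ∃ k : ℤ, w = k • p := by
  have hg : 0 < Int.gcd (u 0) (u 1) := by
    rw [Int.gcd_pos_iff]
    by_contra! h
    exact hu (by ext i; fin_cases i <;> simp [h.1, h.2])
  obtain ⟨a, b, hab, ha, hb⟩ := Int.exists_gcd_one hg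
  obtain ⟨r, s, hrs⟩ := Int.isCoprime_iff_gcd_eq_one.mpr hab
  refine ⟨![a, b], fun w hw => ⟨r * w 0 + s * w 1, ?_⟩⟩
  have hg' : (Int.gcd (u 0) (u 1) : ℤ) ≠ 0 := by exact_mod_cast hg.ne'
  have hpar : a * w 1 = b * w 0 := by
    apply mul_right_cancel₀ hg'
    linear_combination hw - w 1 * ha + w 0 * hb
  ext i
  fin_cases i
  · simp
    linear_combination (-w 0) * hrs - s * hpar
  · simp
    linear_combination (-w 1) * hrs + r * hpar

/-- If `L = A·ℤ²` is a lattice of covolume 1 in `ℝ²` with `‖L‖ < 1`, then the minimal norm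
of `L` is attained at exactly two vectors `l` and `-l`. -/
theorem stmt1 (A : Matrix (Fin 2) (Fin 2) ℝ) (hA : |A.det| = 1)
    (hnorm : setMinNorm (lat2 A) < 1) :
    ∃ l ∈ lat2 A, l ≠ 0 ∧
      {v ∈ lat2 A | ‖v‖ = setMinNorm (lat2 A)} = {l, -l} := by
  have hzero : latVec A 0 = 0 := by simpa using latVec_zsmul A 0 0
  have hne : {r : ℝ | ∃ x ∈ lat2 A, x ≠ 0 ∧ ‖x‖ = r}.Nonempty := by
    by_contra! h
    have hall (v : Fin 2 → ℤ) : latVec A v = 0 := by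
      by_contra hv
      exact (Set.eq_empty_iff_forall_notMem.mp h) _ ⟨latVec A v, ⟨v, rfl⟩, hv, rfl⟩
    have hentry (i : Fin 2) : A i 0 = 0 := by
      have := congrArg (fun x : EuclideanSpace ℝ (Fin 2) => x i) (hall ![1, 0])
      simpa [latVec_apply] using this
    simp [Matrix.det_fin_two, hentry] at hA
  obtain ⟨_, ⟨_, ⟨u, rfl⟩, hu0, rfl⟩, hu1⟩ := exists_lt_of_csInf_lt hne hnorm
  change latVec A u ≠ 0 at hu0
  change ‖latVec A u‖ < 1 at hu1
  obtain ⟨p, hp⟩ := exists_primitive (u := u) (by rintro rfl; exact hu0 hzero)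
  have hshort (w : Fin 2 → ℤ) (hw : ‖latVec A w‖ < 1) :
      ∃ k : ℤ, latVec A w = (k : ℝ) • latVec A p := by
    obtain ⟨k, rfl⟩ := hp w (int_cross_eq_zero_of_norm_lt_one hA hu1 hw)
    exact ⟨k, latVec_zsmul A k p⟩
  have hmul (w : Fin 2 → ℤ) (hw0 : latVec A w ≠ 0) (hw : ‖latVec A w‖ < 1) :
      ‖latVec A p‖ ≤ ‖latVec A w‖ := by
    obtain ⟨k, hk⟩ := hshort w hw
    have hk0 : k ≠ 0 := by
      rintro rfl
      exact hw0 (by simpa using hk)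
    have hk1 : (1 : ℝ) ≤ |(k : ℝ)| := by exact_mod_cast Int.one_le_abs hk0
    rw [hk, norm_smul, Real.norm_eq_abs]
    exact le_mul_of_one_le_left (norm_nonneg _) hk1
  have hp0 : latVec A p ≠ 0 := by
    obtain ⟨k, hk⟩ := hshort u hu1
    intro h
    exact hu0 (by rw [hk, h, smul_zero])
  have hp1 : ‖latVec A p‖ < 1 := (hmul u hu0 hu1).trans_lt hu1
  have hmin : setMinNorm (lat2 A) = ‖latVec A p‖ := by
    refine IsLeast.csInf_eq ⟨⟨latVec A p, ⟨p, rfl⟩, hp0, rfl⟩, ?_⟩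
    rintro _ ⟨_, ⟨w, rfl⟩, hw0, rfl⟩
    rcases lt_or_ge ‖latVec A w‖ 1 with hw | hw
    · exact hmul w hw0 hw
    · exact hp1.le.trans hw
  refine ⟨latVec A p, ⟨p, rfl⟩, hp0, ?_⟩
  rw [hmin]
  ext x
  simp only [Set.mem_sep_iff, Set.mem_insert_iff, Set.mem_singleton_iff]
  constructor
  · rintro ⟨⟨w, rfl⟩, hw⟩
    change ‖latVec A w‖ = _ at hw
    change latVec A w = _ ∨ latVec A w = _
    obtain ⟨k, hk⟩ := hshort w (hw ▸ hp1)
    rw [hk, norm_smul, Real.norm_eq_abs, mul_eq_right₀ (norm_ne_zero_iff.mpr hp0)] at hw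
    rw [hk]
    rcases eq_or_eq_neg_of_abs_eq hw with h | h <;> simp [h]
  · rintro (rfl | rfl)
    · exact ⟨⟨p, rfl⟩, rfl⟩
    · refine ⟨⟨(-1 : ℤ) • p, ?_⟩, norm_neg _⟩
      change _ = latVec A _
      rw [latVec_zsmul]
      simp
end
end

section
/- Let L be a lattice in ℝ² of covolume 1 with ‖L‖ ≤ 1, and let ‖L‖₂ be the smallest radius r such that the closed Euclidean ball of center 0 and radius r contains two linearly independent vectors of L. Then exactly one of the following holds: (i) ‖L‖ = ‖L‖₂; in this case ‖L‖ = 1, there is a rotation R ∈ SO(2,ℝ) with L = R·ℤ², and the minimal norm ‖L‖ is attained at exactly 4 vectors of L; or (ii) ‖L‖ < ‖L‖₂, and the minimal norm ‖L‖ is attained at exactly 2 vectors of L. -/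
noncomputable section

/-- `‖L‖₂`: the smallest radius `r > 0` such that the closed ball of center `0` and radius
`r` contains two linearly independent vectors of `L`. -/
def setMinNorm₂ {d : ℕ} (L : Set (EuclideanSpace ℝ (Fin d))) : ℝ :=
  sInf {r : ℝ | 0 < r ∧ ∃ v ∈ L, ∃ w ∈ L, ‖v‖ ≤ r ∧ ‖w‖ ≤ r ∧ LinearIndependent ℝ ![v, w]}

/-- The determinant of the two vectors `x, y` of the plane. -/
def cross (x y : EuclideanSpace ℝ (Fin 2)) : ℝ := x 0 * y 1 - x 1 * y 0

lemma norm_sq_fin_two (x : EuclideanSpace ℝ (Fin 2)) : ‖x‖ ^ 2 = x 0 ^ 2 + x 1 ^ 2 := by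
  simp [EuclideanSpace.real_norm_sq_eq, Fin.sum_univ_two]

lemma eq_of_coords {x y : EuclideanSpace ℝ (Fin 2)} (h0 : x 0 = y 0) (h1 : x 1 = y 1) :
    x = y := by
  ext i
  fin_cases i <;> assumption

lemma mem_lat2_iff {A : Matrix (Fin 2) (Fin 2) ℝ} {x : EuclideanSpace ℝ (Fin 2)} :
    x ∈ lat2 A ↔
      ∃ a b : ℤ, x 0 = A 0 0 * a + A 0 1 * b ∧ x 1 = A 1 0 * a + A 1 1 * b := by
  constructor
  · rintro ⟨v, rfl⟩
    exact ⟨v 0, v 1, by simp⟩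
  · rintro ⟨a, b, h0, h1⟩
    refine ⟨![a, b], eq_of_coords ?_ ?_⟩ <;>
      simp [h0, h1]

lemma neg_mem_lat2 {A : Matrix (Fin 2) (Fin 2) ℝ} {x : EuclideanSpace ℝ (Fin 2)}
    (hx : x ∈ lat2 A) : -x ∈ lat2 A := by
  obtain ⟨a, b, h0, h1⟩ := mem_lat2_iff.1 hx
  refine mem_lat2_iff.2 ⟨-a, -b, ?_, ?_⟩ <;> simp [h0, h1] <;> ring

lemma int_comb_mem_lat2 {A : Matrix (Fin 2) (Fin 2) ℝ} {x y z : EuclideanSpace ℝ (Fin 2)}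
    (hx : x ∈ lat2 A) (hy : y ∈ lat2 A) (m n : ℤ)
    (h0 : z 0 = m * x 0 + n * y 0) (h1 : z 1 = m * x 1 + n * y 1) : z ∈ lat2 A := by
  obtain ⟨a, b, hx0, hx1⟩ := mem_lat2_iff.1 hx
  obtain ⟨c, d, hy0, hy1⟩ := mem_lat2_iff.1 hy
  refine mem_lat2_iff.2 ⟨m * a + n * c, m * b + n * d, ?_, ?_⟩
  · rw [h0, hx0, hy0]; push_cast; ring
  · rw [h1, hx1, hy1]; push_cast; ring

lemma exists_int_cross {A : Matrix (Fin 2) (Fin 2) ℝ} (hA : |A.det| = 1)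
    {x y : EuclideanSpace ℝ (Fin 2)} (hx : x ∈ lat2 A) (hy : y ∈ lat2 A) :
    ∃ n : ℤ, cross x y = n := by
  obtain ⟨a, b, hx0, hx1⟩ := mem_lat2_iff.1 hx
  obtain ⟨c, d, hy0, hy1⟩ := mem_lat2_iff.1 hy
  have key : cross x y = A.det * (a * d - b * c) := by
    rw [cross, hx0, hx1, hy0, hy1, Matrix.det_fin_two]; ring
  rcases eq_or_eq_neg_of_abs_eq hA with h | h
  · exact ⟨a * d - b * c, by rw [key, h]; push_cast; ring⟩
  · exact ⟨-(a * d - b * c), by rw [key, h]; push_cast; ring⟩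

lemma lat2_inter_closedBall_finite {A : Matrix (Fin 2) (Fin 2) ℝ} (hA : |A.det| = 1) (r : ℝ) :
    {x ∈ lat2 A | ‖x‖ ≤ r}.Finite := by
  set B : ℝ := (|A 0 0| + |A 0 1| + |A 1 0| + |A 1 1|) * r
  refine ((Set.finite_Icc (fun _ : Fin 2 => -⌈B⌉) (fun _ => ⌈B⌉)).image
    (fun v => (WithLp.equiv 2 (Fin 2 → ℝ)).symm (A.mulVec fun i => (v i : ℝ)))).subset ?_
  rintro x ⟨⟨v, rfl⟩, hx⟩
  refine ⟨v, ?_, rfl⟩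
  set x := (WithLp.equiv 2 (Fin 2 → ℝ)).symm (A.mulVec fun i => (v i : ℝ)) with hxdef
  have hx0 : x 0 = A 0 0 * v 0 + A 0 1 * v 1 := by
    simp [hxdef]
  have hx1 : x 1 = A 1 0 * v 0 + A 1 1 * v 1 := by
    simp [hxdef]
  have hr0 : |x 0| ≤ r := by simpa using (PiLp.norm_apply_le x 0).trans hx
  have hr1 : |x 1| ≤ r := by simpa using (PiLp.norm_apply_le x 1).trans hx
  have hr : 0 ≤ r := (abs_nonneg _).trans hr0
  have bound : ∀ p q : ℝ, |p * x 0 - q * x 1| ≤ (|p| + |q|) * r := fun p q => by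
    calc |p * x 0 - q * x 1| ≤ |p * x 0| + |q * x 1| := abs_sub _ _
      _ = |p| * |x 0| + |q| * |x 1| := by rw [abs_mul, abs_mul]
      _ ≤ (|p| + |q|) * r := by rw [add_mul]; gcongr
  have h0 : |(v 0 : ℝ)| ≤ B := by
    calc |(v 0 : ℝ)| = |A.det * v 0| := by rw [abs_mul, hA, one_mul]
      _ = |A 1 1 * x 0 - A 0 1 * x 1| := by
        rw [hx0, hx1, Matrix.det_fin_two]; congr 1; ring
      _ ≤ (|A 1 1| + |A 0 1|) * r := bound _ _
      _ ≤ B := by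
        exact mul_le_mul_of_nonneg_right (by linarith [abs_nonneg (A 0 0), abs_nonneg (A 1 0)]) hr
  have h1 : |(v 1 : ℝ)| ≤ B := by
    calc |(v 1 : ℝ)| = |A.det * v 1| := by rw [abs_mul, hA, one_mul]
      _ = |A 1 0 * x 0 - A 0 0 * x 1| := by
        rw [hx0, hx1, Matrix.det_fin_two, abs_sub_comm]; congr 1; ring
      _ ≤ (|A 1 0| + |A 0 0|) * r := bound _ _
      _ ≤ B := by
        exact mul_le_mul_of_nonneg_right (by linarith [abs_nonneg (A 0 1), abs_nonneg (A 1 1)]) hr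
  have int_bound : ∀ n : ℤ, |(n : ℝ)| ≤ B → -⌈B⌉ ≤ n ∧ n ≤ ⌈B⌉ := fun n hn => by
    have := abs_le.1 (show |n| ≤ ⌈B⌉ by exact_mod_cast hn.trans (Int.le_ceil B))
    exact this
  constructor <;> intro i <;> fin_cases i
  exacts [(int_bound _ h0).1, (int_bound _ h1).1, (int_bound _ h0).2, (int_bound _ h1).2]

lemma exists_norm_minimal_of_subset_lat2 {A : Matrix (Fin 2) (Fin 2) ℝ} (hA : |A.det| = 1)
    {T : Set (EuclideanSpace ℝ (Fin 2))} (hT : T ⊆ lat2 A) (hne : T.Nonempty) :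
    ∃ x ∈ T, ∀ y ∈ T, ‖x‖ ≤ ‖y‖ := by
  obtain ⟨z, hz⟩ := hne
  have hfin : {x ∈ T | ‖x‖ ≤ ‖z‖}.Finite :=
    (lat2_inter_closedBall_finite hA ‖z‖).subset fun x hx => ⟨hT hx.1, hx.2⟩
  obtain ⟨x, hx, hmin⟩ := Set.exists_min_image _ (fun x => ‖x‖) hfin ⟨z, hz, le_rfl⟩
  refine ⟨x, hx.1, fun y hy => ?_⟩
  rcases le_total ‖y‖ ‖z‖ with h | h
  · exact hmin y ⟨hy, h⟩
  · exact hx.2.trans h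

lemma linearIndependent_of_cross_ne_zero {x y : EuclideanSpace ℝ (Fin 2)}
    (h : cross x y ≠ 0) : LinearIndependent ℝ ![x, y] := by
  rw [LinearIndependent.pair_iff]
  intro s t hst
  have e0 : s * x 0 + t * y 0 = 0 := by simpa using congrArg (fun z => z 0) hst
  have e1 : s * x 1 + t * y 1 = 0 := by simpa using congrArg (fun z => z 1) hst
  constructor
  · refine (mul_eq_zero.1 ?_).resolve_right h
    rw [cross]; linear_combination y 1 * e0 - y 0 * e1
  · refine (mul_eq_zero.1 ?_).resolve_right h
    rw [cross]; linear_combination x 0 * e1 - x 1 * e0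

lemma cross_ne_zero_of_linearIndependent {x y : EuclideanSpace ℝ (Fin 2)}
    (h : LinearIndependent ℝ ![x, y]) : cross x y ≠ 0 := by
  intro hc
  rw [cross] at hc
  have h0 := LinearIndependent.pair_iff.1 h (y 0) (-x 0) (eq_of_coords
    (by simp; ring) (by simp; linear_combination -hc))
  have h1 := LinearIndependent.pair_iff.1 h (y 1) (-x 1) (eq_of_coords
    (by simp; linear_combination hc) (by simp; ring))
  have hx : x = 0 := eq_of_coords (by simpa using h0.2) (by simpa using h1.2)
  exact h.ne_zero 0 (by simpa using hx)

lemma cross_ne_zero_or_of_linearIndependent {u x y : EuclideanSpace ℝ (Fin 2)}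
    (hu : u ≠ 0) (h : LinearIndependent ℝ ![x, y]) : cross u x ≠ 0 ∨ cross u y ≠ 0 := by
  by_contra! hc
  obtain ⟨hx, hy⟩ := hc
  have hxy := cross_ne_zero_of_linearIndependent h
  rw [cross] at hx hy
  refine hu (eq_of_coords ?_ ?_)
  · refine (mul_eq_zero.1 ?_).resolve_right hxy
    rw [cross]; linear_combination x 0 * hy - y 0 * hx
  · refine (mul_eq_zero.1 ?_).resolve_right hxy
    rw [cross]; linear_combination x 1 * hy - y 1 * hx

lemma exists_setMinNorm_eq_norm {A : Matrix (Fin 2) (Fin 2) ℝ} (hA : |A.det| = 1) :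
    ∃ u ∈ lat2 A, u ≠ 0 ∧ setMinNorm (lat2 A) = ‖u‖ ∧
      ∀ x ∈ lat2 A, x ≠ 0 → ‖u‖ ≤ ‖x‖ := by
  have hne : {x ∈ lat2 A | x ≠ 0}.Nonempty := by
    by_contra hcon
    have hz : ∀ a b : ℤ, A 0 0 * a + A 0 1 * b = 0 ∧ A 1 0 * a + A 1 1 * b = 0 := by
      intro a b
      have hmem : !₂[A 0 0 * a + A 0 1 * b, A 1 0 * a + A 1 1 * b] ∈ lat2 A :=
        mem_lat2_iff.2 ⟨a, b, by simp⟩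
      by_contra hab
      refine hcon ⟨_, hmem, fun h => hab ⟨?_, ?_⟩⟩
      · simpa using congrArg (fun z => z 0) h
      · simpa using congrArg (fun z => z 1) h
    have h1 := hz 1 0
    simp only [Int.cast_one, Int.cast_zero, mul_one, mul_zero, add_zero] at h1
    rw [Matrix.det_fin_two, h1.1, h1.2] at hA
    simp at hA
  obtain ⟨u, hu, hmin⟩ := exists_norm_minimal_of_subset_lat2 hA (fun x hx => hx.1) hne
  refine ⟨u, hu.1, hu.2, IsLeast.csInf_eq ⟨⟨u, hu.1, hu.2, rfl⟩, ?_⟩,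
    fun x hx hx0 => hmin x ⟨hx, hx0⟩⟩
  rintro r ⟨x, hx, hx0, rfl⟩
  exact hmin x ⟨hx, hx0⟩

lemma exists_mem_lat2_cross_ne_zero {A : Matrix (Fin 2) (Fin 2) ℝ} (hA : |A.det| = 1)
    {u : EuclideanSpace ℝ (Fin 2)} (hu : u ≠ 0) : ∃ x ∈ lat2 A, cross u x ≠ 0 := by
  have hdet : A.det ≠ 0 := by
    intro h
    simp [h] at hA
  have h1 : !₂[A 0 0, A 1 0] ∈ lat2 A := mem_lat2_iff.2 ⟨1, 0, by simp⟩
  have h2 : !₂[A 0 1, A 1 1] ∈ lat2 A := mem_lat2_iff.2 ⟨0, 1, by simp⟩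
  have hind : LinearIndependent ℝ ![!₂[A 0 0, A 1 0], !₂[A 0 1, A 1 1]] := by
    refine linearIndependent_of_cross_ne_zero fun h => hdet ?_
    rw [Matrix.det_fin_two]
    simp only [cross] at h
    simpa [mul_comm] using h
  rcases cross_ne_zero_or_of_linearIndependent hu hind with h | h
  exacts [⟨_, h1, h⟩, ⟨_, h2, h⟩]

lemma setMinNorm₂_eq_of_cross_ne_zero {L : Set (EuclideanSpace ℝ (Fin 2))}
    {u w : EuclideanSpace ℝ (Fin 2)} (hu : u ∈ L) (hu0 : u ≠ 0)
    (hmin : ∀ x ∈ L, x ≠ 0 → ‖u‖ ≤ ‖x‖) (hw : w ∈ L) (hwu : ‖w‖ = ‖u‖)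
    (hc : cross u w ≠ 0) : setMinNorm₂ L = ‖u‖ := by
  refine IsLeast.csInf_eq ⟨⟨norm_pos_iff.2 hu0, u, hu, w, hw, le_rfl, hwu.le,
    linearIndependent_of_cross_ne_zero hc⟩, ?_⟩
  rintro r ⟨-, x, hx, y, -, hxr, -, hxy⟩
  exact (hmin x hx (by simpa using hxy.ne_zero 0)).trans hxr

lemma lt_setMinNorm₂ {A : Matrix (Fin 2) (Fin 2) ℝ} (hA : |A.det| = 1)
    {u : EuclideanSpace ℝ (Fin 2)} (hu : u ∈ lat2 A) (hu0 : u ≠ 0)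
    (hlt : ∀ x ∈ lat2 A, cross u x ≠ 0 → ‖u‖ < ‖x‖) : ‖u‖ < setMinNorm₂ (lat2 A) := by
  obtain ⟨z, hz, hzc⟩ := exists_mem_lat2_cross_ne_zero hA hu0
  obtain ⟨w, hw, hmin⟩ := exists_norm_minimal_of_subset_lat2 hA
    (T := {x ∈ lat2 A | cross u x ≠ 0}) (fun x hx => hx.1) ⟨z, hz, hzc⟩
  refine (hlt w hw.1 hw.2).trans_le (le_csInf ?_ ?_)
  · exact ⟨max ‖u‖ ‖z‖, lt_max_of_lt_left (norm_pos_iff.2 hu0), u, hu, z, hz,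
      le_max_left _ _, le_max_right _ _, linearIndependent_of_cross_ne_zero hzc⟩
  · rintro r ⟨-, x, hx, y, hy, hxr, hyr, hxy⟩
    rcases cross_ne_zero_or_of_linearIndependent hu0 hxy with h | h
    exacts [(hmin x ⟨hx, h⟩).trans hxr, (hmin y ⟨hy, h⟩).trans hyr]

lemma eq_or_eq_neg_of_cross_eq_zero {u x : EuclideanSpace ℝ (Fin 2)} (hn : ‖x‖ = ‖u‖)
    (hc : cross u x = 0) : x = u ∨ x = -u := by
  have hsq : x 0 ^ 2 + x 1 ^ 2 = u 0 ^ 2 + u 1 ^ 2 := by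
    rw [← norm_sq_fin_two, ← norm_sq_fin_two, hn]
  rw [cross] at hc
  set N := u 0 ^ 2 + u 1 ^ 2 with hN
  have hprod : (u 0 * x 0 + u 1 * x 1 - N) * (u 0 * x 0 + u 1 * x 1 + N) = 0 := by
    rw [hN]
    linear_combination (u 0 ^ 2 + u 1 ^ 2) * hsq - (u 0 * x 1 - u 1 * x 0) * hc
  rcases mul_eq_zero.1 hprod with h | h
  · have h2 : (x 0 - u 0) ^ 2 + (x 1 - u 1) ^ 2 = 0 := by
      rw [hN] at h hsq; linear_combination hsq - 2 * h
    left
    exact eq_of_coords (by nlinarith [sq_nonneg (x 0 - u 0), sq_nonneg (x 1 - u 1)])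
      (by nlinarith [sq_nonneg (x 0 - u 0), sq_nonneg (x 1 - u 1)])
  · have h2 : (x 0 + u 0) ^ 2 + (x 1 + u 1) ^ 2 = 0 := by
      rw [hN] at h hsq; linear_combination hsq + 2 * h
    right
    refine eq_of_coords ?_ ?_ <;> simp only [PiLp.neg_apply] <;>
      nlinarith [sq_nonneg (x 0 + u 0), sq_nonneg (x 1 + u 1)]

lemma self_ne_neg_of_ne_zero {x : EuclideanSpace ℝ (Fin 2)} (hx : x ≠ 0) : x ≠ -x := by
  intro h
  have key : ∀ i, x i = 0 := fun i => by
    have hi : x i = -x i := congrArg (fun z => z i) h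
    linarith
  exact hx (eq_of_coords (key 0) (key 1))

lemma cross_neg_right (x y : EuclideanSpace ℝ (Fin 2)) : cross x (-y) = -cross x y := by
  simp [cross]; ring

lemma cross_self_eq_zero (x : EuclideanSpace ℝ (Fin 2)) : cross x x = 0 := by
  rw [cross]; ring

/-- Two independent minimal vectors of norm at most `1` in a unimodular lattice can be chosen,
up to sign, to be a positively oriented orthonormal pair. -/
lemma exists_orthonormal_of_cross_ne_zero {A : Matrix (Fin 2) (Fin 2) ℝ} (hA : |A.det| = 1)
    {u w : EuclideanSpace ℝ (Fin 2)} (hu : u ∈ lat2 A) (hle : ‖u‖ ≤ 1)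
    (hw : w ∈ lat2 A) (hwu : ‖w‖ = ‖u‖) (hc : cross u w ≠ 0) :
    ∃ w' ∈ lat2 A, ‖u‖ = 1 ∧ ‖w'‖ = 1 ∧ cross u w' = 1 ∧ u 0 * w' 0 + u 1 * w' 1 = 0 := by
  wlog hpos : 0 < cross u w generalizing w
  · refine this (neg_mem_lat2 hw) (by rwa [norm_neg]) ?_ ?_
    · rwa [cross_neg_right, neg_ne_zero]
    · rw [cross_neg_right, neg_pos]
      exact lt_of_le_of_ne (not_lt.1 hpos) hc
  obtain ⟨n, hn⟩ := exists_int_cross hA hu hw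
  have hn1 : (1 : ℝ) ≤ cross u w := by
    rw [hn] at hpos ⊢
    exact_mod_cast hpos
  have lagrange : cross u w ^ 2 + (u 0 * w 0 + u 1 * w 1) ^ 2 = (‖u‖ ^ 2) ^ 2 := by
    have h1 := norm_sq_fin_two u
    have h2 := norm_sq_fin_two w
    rw [hwu] at h2
    calc cross u w ^ 2 + (u 0 * w 0 + u 1 * w 1) ^ 2
        = (u 0 ^ 2 + u 1 ^ 2) * (w 0 ^ 2 + w 1 ^ 2) := by rw [cross]; ring
      _ = (‖u‖ ^ 2) ^ 2 := by rw [← h1, ← h2]; ring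
  have hsq : ‖u‖ ^ 2 ≤ 1 := pow_le_one₀ (norm_nonneg u) hle
  have hsq1 : (‖u‖ ^ 2) ^ 2 ≤ 1 := pow_le_one₀ (sq_nonneg _) hsq
  have hc2 : 1 ≤ cross u w ^ 2 := one_le_pow₀ hn1
  have hin : (u 0 * w 0 + u 1 * w 1) ^ 2 = 0 :=
    le_antisymm (by linarith) (sq_nonneg _)
  have hu1 : (‖u‖ ^ 2) ^ 2 = 1 :=
    le_antisymm hsq1 (by linarith [sq_nonneg (u 0 * w 0 + u 1 * w 1)])
  have hcr : cross u w = 1 := by nlinarith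
  have hnorm : ‖u‖ = 1 := by
    rw [← pow_mul] at hu1
    exact (pow_eq_one_iff_of_nonneg (norm_nonneg u) (by norm_num)).1 hu1
  exact ⟨w, hw, hnorm, hwu.trans hnorm, hcr, pow_eq_zero_iff two_ne_zero |>.1 hin⟩

lemma lat2_eq_of_cross_eq_one {A : Matrix (Fin 2) (Fin 2) ℝ} (hA : |A.det| = 1)
    {u w : EuclideanSpace ℝ (Fin 2)} (hu : u ∈ lat2 A) (hw : w ∈ lat2 A)
    (hc : cross u w = 1) : lat2 A = lat2 !![u 0, w 0; u 1, w 1] := by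
  ext x
  constructor
  · intro hx
    obtain ⟨a, ha⟩ := exists_int_cross hA hx hw
    obtain ⟨b, hb⟩ := exists_int_cross hA hu hx
    refine mem_lat2_iff.2 ⟨a, b, ?_, ?_⟩
    · rw [← ha, ← hb]
      simp only [cross, Matrix.of_apply, Matrix.cons_val', Matrix.cons_val_zero,
        Matrix.cons_val_one, Matrix.cons_val_fin_one] at hc ⊢
      linear_combination -x 0 * hc
    · rw [← ha, ← hb]
      simp only [cross, Matrix.of_apply, Matrix.cons_val', Matrix.cons_val_zero,
        Matrix.cons_val_one, Matrix.cons_val_fin_one] at hc ⊢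
      linear_combination -x 1 * hc
  · intro hx
    obtain ⟨a, b, h0, h1⟩ := mem_lat2_iff.1 hx
    refine int_comb_mem_lat2 hu hw a b ?_ ?_
    · simpa [mul_comm] using h0
    · simpa [mul_comm] using h1

lemma eq_zero_or_eq_zero_of_sq_add_sq_eq_one {a b : ℤ} (h : a ^ 2 + b ^ 2 = 1) :
    a = 0 ∨ b = 0 := by
  by_contra! hab
  have ha : 0 < a ^ 2 := by have := hab.1; positivity
  have hb : 0 < b ^ 2 := by have := hab.2; positivity
  omega

lemma lat2_norm_one_eq {A : Matrix (Fin 2) (Fin 2) ℝ} (hA : |A.det| = 1)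
    {u w : EuclideanSpace ℝ (Fin 2)} (hu : u ∈ lat2 A) (hw : w ∈ lat2 A)
    (hu1 : ‖u‖ = 1) (hw1 : ‖w‖ = 1) (hc : cross u w = 1)
    (ho : u 0 * w 0 + u 1 * w 1 = 0) :
    {x ∈ lat2 A | ‖x‖ = 1} = {u, -u, w, -w} := by
  ext x
  simp only [Set.mem_ofPred_eq, Set.mem_insert_iff, Set.mem_singleton_iff]
  constructor
  · rintro ⟨hx, hx1⟩
    obtain ⟨a, ha⟩ := exists_int_cross hA hw hx
    obtain ⟨b, hb⟩ := exists_int_cross hA hu hx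
    have hux := norm_sq_fin_two u
    have hxx := norm_sq_fin_two x
    rw [hu1] at hux
    rw [hx1] at hxx
    have hwu0 : w 0 = -u 1 := by
      rw [cross] at hc
      linear_combination u 0 * ho - u 1 * hc + w 0 * hux
    have hwu1 : w 1 = u 0 := by
      rw [cross] at hc
      linear_combination u 1 * ho + u 0 * hc + w 1 * hux
    have hsum : (a : ℝ) ^ 2 + (b : ℝ) ^ 2 = 1 := by
      rw [← ha, ← hb, cross, cross, hwu0, hwu1]
      linear_combination -(x 0 ^ 2 + x 1 ^ 2) * hux - hxx
    rcases eq_zero_or_eq_zero_of_sq_add_sq_eq_one (a := a) (b := b) (by exact_mod_cast hsum) with h | h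
    · rw [h, Int.cast_zero] at ha
      have := eq_or_eq_neg_of_cross_eq_zero (hx1.trans hw1.symm) ha
      tauto
    · rw [h, Int.cast_zero] at hb
      have := eq_or_eq_neg_of_cross_eq_zero (hx1.trans hu1.symm) hb
      tauto
  · rintro (rfl | rfl | rfl | rfl)
    exacts [⟨hu, hu1⟩, ⟨neg_mem_lat2 hu, by rwa [norm_neg]⟩, ⟨hw, hw1⟩,
      ⟨neg_mem_lat2 hw, by rwa [norm_neg]⟩]

lemma ncard_insert_neg_of_cross_ne_zero {u w : EuclideanSpace ℝ (Fin 2)}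
    (hc : cross u w ≠ 0) : ({u, -u, w, -w} : Set (EuclideanSpace ℝ (Fin 2))).ncard = 4 := by
  have hu : u ≠ 0 := by rintro rfl; simp [cross] at hc
  have hw : w ≠ 0 := by rintro rfl; simp [cross] at hc
  have h1 : u ≠ w := by rintro rfl; exact hc (cross_self_eq_zero u)
  have h2 : u ≠ -w := by
    intro h
    have h' : w = -u := by rw [h, neg_neg]
    exact hc (by rw [h', cross_neg_right, cross_self_eq_zero, neg_zero])
  have h3 : -u ≠ w := fun h => h2 (by rw [← h, neg_neg])
  rw [Set.ncard_insert_of_notMem, Set.ncard_insert_of_notMem, Set.ncard_pair]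
  · exact self_ne_neg_of_ne_zero hw
  · simp [h1, h3]
  · simp [h1, h2, self_ne_neg_of_ne_zero hu]

/-- Dichotomy for a covolume-one lattice `L = A·ℤ²` in `ℝ²` with `‖L‖ ≤ 1`: either
`‖L‖ = ‖L‖₂`, in which case `‖L‖ = 1`, `L` is a rotation of `ℤ²` and the minimal norm is
attained at exactly `4` vectors; or `‖L‖ < ‖L‖₂`, in which case the minimal norm is attained
at exactly `2` vectors. Exactly one of the two cases occurs. -/
theorem stmt2 (A : Matrix (Fin 2) (Fin 2) ℝ) (hA : |A.det| = 1)
    (hnorm : setMinNorm (lat2 A) ≤ 1) :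
    Xor'
      (setMinNorm (lat2 A) = setMinNorm₂ (lat2 A) ∧
        setMinNorm (lat2 A) = 1 ∧
        (∃ R : Matrix (Fin 2) (Fin 2) ℝ, R.det = 1 ∧ R.transpose * R = 1 ∧ lat2 A = lat2 R) ∧
        {v ∈ lat2 A | ‖v‖ = setMinNorm (lat2 A)}.ncard = 4)
      (setMinNorm (lat2 A) < setMinNorm₂ (lat2 A) ∧
        {v ∈ lat2 A | ‖v‖ = setMinNorm (lat2 A)}.ncard = 2) := by
  obtain ⟨u, hu, hu0, hm, hmin⟩ := exists_setMinNorm_eq_norm hA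
  rw [hm] at hnorm ⊢
  by_cases hex : ∃ w ∈ lat2 A, ‖w‖ = ‖u‖ ∧ cross u w ≠ 0
  · obtain ⟨w, hw, hwu, hc⟩ := hex
    have hm₂ := setMinNorm₂_eq_of_cross_ne_zero hu hu0 hmin hw hwu hc
    obtain ⟨w', hw', hu1, hw1, hc', ho⟩ :=
      exists_orthonormal_of_cross_ne_zero hA hu hnorm hw hwu hc
    refine Or.inl ⟨⟨hm₂.symm, hu1, ⟨!![u 0, w' 0; u 1, w' 1], ?_, ?_,
      lat2_eq_of_cross_eq_one hA hu hw' hc'⟩, ?_⟩, fun h => (hm₂ ▸ h.1).false⟩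
    · rw [Matrix.det_fin_two_of, ← hc', cross]; ring
    · have hux := norm_sq_fin_two u
      have hwx := norm_sq_fin_two w'
      rw [hu1] at hux
      rw [hw1] at hwx
      ext i j
      fin_cases i <;> fin_cases j <;>
        simp [Matrix.mul_apply, Fin.sum_univ_two] <;> linarith
    · rw [hu1, lat2_norm_one_eq hA hu hw' hu1 hw1 hc' ho]
      exact ncard_insert_neg_of_cross_ne_zero (by rw [hc']; exact one_ne_zero)
  · push Not at hex
    have hlt := lt_setMinNorm₂ hA hu hu0 fun x hx hxc =>
      lt_of_le_of_ne (hmin x hx (by rintro rfl; simp [cross] at hxc))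
        fun h => hxc (hex x hx h.symm)
    have hset : {v ∈ lat2 A | ‖v‖ = ‖u‖} = {u, -u} := by
      ext x
      simp only [Set.mem_ofPred_eq, Set.mem_insert_iff, Set.mem_singleton_iff]
      constructor
      · rintro ⟨hx, hxn⟩
        exact eq_or_eq_neg_of_cross_eq_zero hxn (hex x hx hxn)
      · rintro (rfl | rfl)
        exacts [⟨hu, rfl⟩, ⟨neg_mem_lat2 hu, norm_neg u⟩]
    refine Or.inr ⟨⟨hlt, ?_⟩, fun h => hlt.ne h.1⟩
    rw [hset, Set.ncard_pair (self_ne_neg_of_ne_zero hu0)]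
end
end

section
/- Let L be a full-rank lattice in ℝ^d with ‖L‖₂ > ‖L‖₁ > 0, and let l ∈ L be a vector with ‖l‖ = ‖L‖₁. Then for every k = (k₁,…,k_d) ∈ ℤ^d with k₁ + ⋯ + k_d = 0 and ‖L‖₂ > e^{2‖k‖_∞}·‖L‖₁, one has ‖δ_k L‖₁ = ‖δ_k l‖, i.e. δ_k l realizes the minimal norm of the lattice δ_k L = {δ_k v : v ∈ L}, where δ_k = diag(e^{k₁},…,e^{k_d}). -/
noncomputable section

/-- The diagonal flow `δ_t = diag(e^{t₁}, …, e^{t_d})` acting on `ℝ^d`. -/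
def diagFlow {d : ℕ} (t : Fin d → ℝ) (x : EuclideanSpace ℝ (Fin d)) :
    EuclideanSpace ℝ (Fin d) :=
  (WithLp.equiv 2 (Fin d → ℝ)).symm fun i => Real.exp (t i) * x i

theorem diagFlow_apply {d : ℕ} (t : Fin d → ℝ) (x : EuclideanSpace ℝ (Fin d)) (i : Fin d) :
    diagFlow t x i = Real.exp (t i) * x i :=
  rfl

theorem diagFlow_smul {d : ℕ} (t : Fin d → ℝ) (c : ℝ) (x : EuclideanSpace ℝ (Fin d)) :
    diagFlow t (c • x) = c • diagFlow t x := by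
  ext i
  simp only [diagFlow_apply, PiLp.smul_apply, smul_eq_mul]
  ring

theorem diagFlow_neg_diagFlow {d : ℕ} (t : Fin d → ℝ) (x : EuclideanSpace ℝ (Fin d)) :
    diagFlow (-t) (diagFlow t x) = x := by
  ext i
  rw [diagFlow_apply, diagFlow_apply, ← mul_assoc, ← Real.exp_add]
  simp

theorem diagFlow_zero {d : ℕ} (t : Fin d → ℝ) :
    diagFlow t (0 : EuclideanSpace ℝ (Fin d)) = 0 := by
  ext i
  simp [diagFlow_apply]

theorem diagFlow_ne_zero {d : ℕ} (t : Fin d → ℝ) {x : EuclideanSpace ℝ (Fin d)} (hx : x ≠ 0) :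
    diagFlow t x ≠ 0 := fun h => hx <| by
  rw [← diagFlow_neg_diagFlow t x, h, diagFlow_zero]

theorem norm_diagFlow_le {d : ℕ} {t : Fin d → ℝ} {r : ℝ} (ht : ∀ i, t i ≤ r)
    (x : EuclideanSpace ℝ (Fin d)) : ‖diagFlow t x‖ ≤ Real.exp r * ‖x‖ := by
  rw [← abs_of_pos (Real.exp_pos r), ← Real.norm_eq_abs, ← norm_smul,
    EuclideanSpace.norm_eq, EuclideanSpace.norm_eq]
  refine Real.sqrt_le_sqrt (Finset.sum_le_sum fun i _ => ?_)
  rw [diagFlow_apply, PiLp.smul_apply, smul_eq_mul, norm_mul, norm_mul, Real.norm_eq_abs,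
    Real.norm_eq_abs (Real.exp r), Real.abs_exp, Real.abs_exp]
  gcongr
  exact ht i

theorem le_exp_mul_norm_diagFlow {d : ℕ} {t : Fin d → ℝ} {r : ℝ} (ht : ∀ i, -t i ≤ r)
    (x : EuclideanSpace ℝ (Fin d)) : ‖x‖ ≤ Real.exp r * ‖diagFlow t x‖ := by
  simpa only [diagFlow_neg_diagFlow] using norm_diagFlow_le (t := -t) ht (diagFlow t x)

theorem setMinNorm_le {E : Type*} [NormedAddCommGroup E] {L : Set E} {x : E} (hx : x ∈ L)
    (hx0 : x ≠ 0) : setMinNorm L ≤ ‖x‖ :=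
  csInf_le ⟨0, by rintro _ ⟨y, -, -, rfl⟩; exact norm_nonneg y⟩ ⟨x, hx, hx0, rfl⟩

theorem setMinNorm₂_le_max {d : ℕ} {L : Set (EuclideanSpace ℝ (Fin d))}
    {v w : EuclideanSpace ℝ (Fin d)} (hv : v ∈ L) (hw : w ∈ L)
    (h : LinearIndependent ℝ ![v, w]) : setMinNorm₂ L ≤ max ‖v‖ ‖w‖ :=
  csInf_le ⟨0, fun _ hr => hr.1.le⟩
    ⟨lt_max_of_lt_left (norm_pos_iff.2 (h.ne_zero 0)), v, hv, w, hw, le_max_left _ _,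
      le_max_right _ _, h⟩

/-- Let `L ⊆ ℝ^d` be a full-rank lattice with `‖L‖₂ > ‖L‖₁ > 0` and let `l ∈ L` with
`‖l‖ = ‖L‖₁`. For every `k ∈ ℤ^d` with `k₁ + ⋯ + k_d = 0` and
`‖L‖₂ > e^{2‖k‖_∞}·‖L‖₁`, the vector `δ_k l` realizes the minimal norm of `δ_k L`
(the norm of `k : Fin d → ℤ` is the sup norm). -/
theorem stmt4 (d : ℕ)
    (L : AddSubgroup (EuclideanSpace ℝ (Fin d)))
    (hdisc : DiscreteTopology L)
    (hspan : Submodule.span ℝ (L : Set (EuclideanSpace ℝ (Fin d))) = ⊤)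
    (hpos : 0 < setMinNorm (L : Set (EuclideanSpace ℝ (Fin d))))
    (hgap : setMinNorm (L : Set (EuclideanSpace ℝ (Fin d)))
      < setMinNorm₂ (L : Set (EuclideanSpace ℝ (Fin d))))
    (l : EuclideanSpace ℝ (Fin d)) (hl : l ∈ L)
    (hlnorm : ‖l‖ = setMinNorm (L : Set (EuclideanSpace ℝ (Fin d))))
    (k : Fin d → ℤ) (hk : ∑ i, k i = 0)
    (hcond : Real.exp (2 * ‖k‖) * setMinNorm (L : Set (EuclideanSpace ℝ (Fin d)))
      < setMinNorm₂ (L : Set (EuclideanSpace ℝ (Fin d)))) :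
    setMinNorm (diagFlow (fun i => (k i : ℝ)) '' (L : Set (EuclideanSpace ℝ (Fin d))))
      = ‖diagFlow (fun i => (k i : ℝ)) l‖ := by
  set t : Fin d → ℝ := fun i => (k i : ℝ) with ht
  have habs : ∀ i, |t i| ≤ ‖k‖ := fun i => by
    simpa [ht, Int.norm_eq_abs] using norm_le_pi_norm k i
  have hl0 : l ≠ 0 := norm_pos_iff.1 (hlnorm ▸ hpos)
  have hmin : ∀ v ∈ L, v ≠ 0 → ‖diagFlow t l‖ ≤ ‖diagFlow t v‖ := by
    intro v hv hv0
    by_cases hind : LinearIndependent ℝ ![l, v]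
    · have hmax := setMinNorm₂_le_max (L := (L : Set (EuclideanSpace ℝ (Fin d)))) hl hv hind
      have hle : setMinNorm₂ (L : Set (EuclideanSpace ℝ (Fin d))) ≤ ‖v‖ :=
        (le_max_iff.1 hmax).resolve_left (by rw [hlnorm]; exact hgap.not_ge)
      have hlow := le_exp_mul_norm_diagFlow (fun i => (neg_le_abs (t i)).trans (habs i)) v
      have hup := norm_diagFlow_le (fun i => (le_abs_self (t i)).trans (habs i)) l
      rw [← hlnorm, two_mul, Real.exp_add, mul_assoc] at hcond
      exact hup.trans (le_of_mul_le_mul_left (hcond.le.trans (hle.trans hlow))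
        (Real.exp_pos ‖k‖))
    · rw [LinearIndependent.pair_iff' hl0] at hind
      push Not at hind
      obtain ⟨c, rfl⟩ := hind
      have hc : 1 * ‖l‖ ≤ ‖c‖ * ‖l‖ := by
        rw [one_mul, ← norm_smul, hlnorm]
        exact setMinNorm_le hv hv0
      rw [diagFlow_smul, norm_smul]
      exact le_mul_of_one_le_left (norm_nonneg _)
        (le_of_mul_le_mul_right hc (norm_pos_iff.2 hl0))
  refine le_antisymm (setMinNorm_le ⟨l, hl, rfl⟩ (diagFlow_ne_zero t hl0)) ?_
  refine le_csInf ⟨_, _, ⟨l, hl, rfl⟩, diagFlow_ne_zero t hl0, rfl⟩ ?_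
  rintro _ ⟨_, ⟨v, hv, rfl⟩, hv0, rfl⟩
  exact hmin v hv fun h => hv0 (by rw [h, diagFlow_zero])
end
end
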